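/- arXiv:1312.6786 — 4 statements merged into one kernel-verified Lean document; each statement's English description precedes it below -/
import Mathlib

section
/- Let R be a commutative ring, h ≥ 1 and d ≥ 1 integers, and A an h×h matrix over R. Let L = L(A,d) be the block companion matrix of A of block size d. Then the characteristic polynomial of L equals the composition (charpoly of A) ∘ X^d, i.e. charpoly(L)(X) = det(X^d·I_h − A) as polynomials in R[X]. -/
/-- The block companion matrix `L(A, d)` of an `h × h` matrix `A` with block size `d`:
a `d × d` array of `h × h` blocks whose top-right block (block position `(0, d-1)`) is `A`,
whose block-subdiagonal blocks (block positions `(i+1, i)`) are the identity, and whose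
other blocks are zero. Rows and columns are indexed by `Fin d × Fin h`, the first component
being the block index. -/
def blockCompanion (R : Type*) [CommRing R] (h d : ℕ) (A : Matrix (Fin h) (Fin h) R) :
    Matrix (Fin d × Fin h) (Fin d × Fin h) R :=
  Matrix.of fun p q =>
    if (p.1 : ℕ) = (q.1 : ℕ) + 1 then (if p.2 = q.2 then 1 else 0)
    else if (p.1 : ℕ) = 0 ∧ (q.1 : ℕ) = d - 1 then A p.2 q.2
    else 0

open Polynomial

/-- The determinant of the characteristic matrix of the companion matrix of `X ^ (n + 1) - y`. -/
theorem det_scalar_sub_companion {S : Type*} [CommRing S] (n : ℕ) (x y : S) :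
    (Matrix.of fun i j : Fin (n + 1) =>
      (if i = j then x else 0) + (if (i : ℕ) = j + 1 then -1 else 0) +
        (if i = 0 ∧ j = Fin.last n then -y else 0)).det = x ^ (n + 1) - y := by
  rw [Matrix.det_succ_row_zero]
  simp only [Matrix.of_apply, Fin.val_zero, Nat.right_eq_add, Nat.add_eq_zero_iff, one_ne_zero,
    and_false, if_false, add_zero, true_and, mul_add, add_mul, mul_ite, ite_mul, mul_zero, zero_mul,
    Finset.sum_add_distrib, Finset.sum_ite_eq, Finset.sum_ite_eq', Finset.mem_univ, if_true,
    pow_zero, one_mul, Fin.val_last]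
  rw [Matrix.det_of_isLowerTriangular, Matrix.det_of_isUpperTriangular]
  · have hne (i : Fin n) : i.succ ≠ i.castSucc := Fin.castSucc_lt_succ.ne'
    simp [pow_succ', mul_right_comm _ y, ← mul_pow, sub_eq_add_neg, hne]
  · intro i j (h : j < i)
    have hne : i.succ ≠ j.castSucc := (Fin.castSucc_lt_succ_iff.2 h.le).ne'
    have hne' : (i : ℕ) ≠ j := by omega
    simp [hne, hne']
  · intro i j (h : i < j)
    have hne : (i : ℕ) ≠ j + 1 := by omega
    simp [hne, h.ne]

/-- the characteristic polynomial of the block companion matrix `L(A, d)`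
is the composition `charpoly(A) ∘ X^d`, i.e. `charpoly(L)(X) = det(X^d • I - A)`. -/
theorem stmt_3 (R : Type*) [CommRing R] (h d : ℕ) (hh : 1 ≤ h) (hd : 1 ≤ d)
    (A : Matrix (Fin h) (Fin h) R) :
    (blockCompanion R h d A).charpoly = A.charpoly.comp (Polynomial.X ^ d) := by
  obtain ⟨n, rfl⟩ := Nat.exists_eq_add_of_le' hd
  let f : R[X][X] →+* Matrix (Fin h) (Fin h) R[X] := (aeval (A.map (C : R →+* R[X]))).toRingHom
  have hfX : f (C X) = Matrix.scalar (Fin h) (X : R[X]) := by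
    simp [f, Matrix.algebraMap_eq_diagonal, Pi.algebraMap_def]
  have hfY : f X = A.map (C : R →+* R[X]) := by simp [f]
  let M : Matrix (Fin (n + 1)) (Fin (n + 1)) R[X][X] := Matrix.of fun i j =>
    (if i = j then C X else 0) + (if (i : ℕ) = j + 1 then (-1 : R[X][X]) else 0) +
      (if i = 0 ∧ j = Fin.last n then -X else 0)
  have hM : Matrix.comp _ _ _ _ R[X] (M.map f) = (blockCompanion R h (n + 1) A).charmatrix := by
    ext1 ⟨i, k⟩ ⟨j, l⟩
    simp only [Matrix.comp_apply, Matrix.map_apply, M, Matrix.of_apply, map_add, apply_ite f,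
      map_zero, map_neg, map_one, hfX, hfY, Matrix.add_apply, Matrix.charmatrix_apply,
      blockCompanion]
    have hlast : j = Fin.last n ↔ (j : ℕ) = n := Fin.ext_iff
    by_cases hij : i = j <;> by_cases hkl : k = l <;> by_cases hsub : (i : ℕ) = j + 1 <;>
      by_cases hi : i = 0 <;> by_cases hj : (j : ℕ) = n <;>
      simp_all [Matrix.diagonal_apply, sub_eq_add_neg]
  rw [Matrix.charpoly, ← hM, ← Matrix.det_det, det_scalar_sub_companion, Matrix.charpoly,
    ← coe_compRingHom_apply, RingHom.map_det]
  congr 1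
  ext1 i j
  rw [map_sub, map_pow, hfX, hfY, ← map_pow]
  by_cases hij : i = j <;> simp [hij]
end

section
/- Let h ≥ 1 and d ≥ 1 be integers, p ∈ ℤ, and set g = gcd(h, p) (with g = h if p = 0). Let w ∈ ℂ with w ≠ 0, let ζ₀ ∈ ℂ satisfy ζ₀^h = w, and let a ∈ ℂ. Then in ℂ[X]: ∏_{ζ : ζ^h = w} (X^d − a·ζ^p) = (X^{dh/g} − a^{h/g}·ζ₀^{ph/g})^g, where the product on the left ranges over the multiset of the h complex roots ζ of X^h − w, and ζ^p denotes the integer power (defined since ζ ≠ 0). -/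
/-- A product over `range (g * n)` of an `n`-periodic function is the `g`-th power of the product
over one period. -/
theorem Finset.prod_range_mul_of_periodic {M : Type*} [CommMonoid M] {f : ℕ → M} {n : ℕ}
    (hf : Function.Periodic f n) (g : ℕ) :
    ∏ i ∈ Finset.range (g * n), f i = (∏ i ∈ Finset.range n, f i) ^ g := by
  induction g with
  | zero => simp
  | succ g ih =>
    rw [Nat.succ_mul, Finset.prod_range_add, ih, pow_succ]
    congr 1
    refine Finset.prod_congr rfl fun i _ => ?_
    rw [add_comm]
    exact hf.nat_mul g i

/-- The `p`-th power of a primitive `h`-th root of unity is a primitive root of unity of order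
`h / gcd(h, p)`. -/
theorem IsPrimitiveRoot.zpow_div_gcd {K : Type*} [Field K] {ξ : K} {h : ℕ}
    (hξ : IsPrimitiveRoot ξ h) (hh : 0 < h) (p : ℤ) :
    IsPrimitiveRoot (ξ ^ p) (h / Int.gcd (h : ℤ) p) := by
  set g := Int.gcd (h : ℤ) p with hg
  have hg0 : 0 < g := Int.gcd_pos_of_ne_zero_left _ (by exact_mod_cast hh.ne')
  have hgh : g ∣ h := by exact_mod_cast Int.gcd_dvd_left (h : ℤ) p
  have hgp : (g : ℤ) ∣ p := Int.gcd_dvd_right (h : ℤ) p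
  have hpow : IsPrimitiveRoot (ξ ^ g) (h / g) := hξ.pow hh (Nat.mul_div_cancel' hgh).symm
  have hcop : Int.gcd (p / g) ((h / g : ℕ) : ℤ) = 1 := by
    rw [Int.gcd_comm, Int.natCast_div]
    exact Int.gcd_div_gcd_div_gcd hg0
  have := hpow.zpow_of_gcd_eq_one _ hcop
  rwa [← zpow_natCast, ← zpow_mul, Int.mul_ediv_cancel' hgp] at this

/-- for `h, d ≥ 1`, `p ∈ ℤ`, `g = gcd(h, p)`, `w ≠ 0` and `ζ₀` with
`ζ₀ ^ h = w`, one has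
`∏_{ζ : ζ^h = w} (X^d - a ζ^p) = (X^{dh/g} - a^{h/g} ζ₀^{p h / g})^g` in `ℂ[X]`,
the product ranging over the multiset of the `h` complex roots of `X ^ h - w`. -/
theorem stmt_6 (h d : ℕ) (hh : 1 ≤ h) (hd : 1 ≤ d) (p : ℤ) (g : ℕ)
    (hg : g = Int.gcd (h : ℤ) p) (w ζ₀ a : ℂ) (hw : w ≠ 0) (hζ : ζ₀ ^ h = w) :
    ((Polynomial.X ^ h - Polynomial.C w).roots.map
      (fun ζ => Polynomial.X ^ d - Polynomial.C (a * ζ ^ p))).prod =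
    (Polynomial.X ^ (d * (h / g)) -
        Polynomial.C (a ^ (h / g) * ζ₀ ^ (p * ((h / g : ℕ) : ℤ)))) ^ g := by
  have hξ := Complex.isPrimitiveRoot_exp h (by omega)
  set ξ := Complex.exp (2 * Real.pi * Complex.I / h)
  have hη : IsPrimitiveRoot (ξ ^ p) (h / g) := hg ▸ hξ.zpow_div_gcd hh p
  have hgh : g ∣ h := by
    rw [hg]
    exact_mod_cast Int.gcd_dvd_left (h : ℤ) p
  have hn : 0 < h / g := Nat.div_pos (Nat.le_of_dvd hh hgh) (Nat.pos_of_dvd_of_pos hgh hh)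
  have hgn : g * (h / g) = h := Nat.mul_div_cancel' hgh
  set n := h / g
  have hfactor := congrArg (fun P => P.comp (Polynomial.X ^ d))
    (X_pow_sub_C_eq_prod hη hn (α := a * ζ₀ ^ p) rfl)
  simp only [Polynomial.sub_comp, Polynomial.pow_comp, Polynomial.X_comp, Polynomial.C_comp,
    Polynomial.prod_comp, ← pow_mul, mul_pow, ← zpow_natCast (ζ₀ ^ p), ← zpow_mul] at hfactor
  have hperiodic : Function.Periodic
      (fun i : ℕ => (Polynomial.X ^ d - Polynomial.C ((ξ ^ p) ^ i * (a * ζ₀ ^ p)))) n := by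
    intro i
    simp only [pow_add, hη.pow_eq_one, mul_one]
  rw [hfactor]
  rw [← Finset.prod_range_mul_of_periodic hperiodic, hgn, ← Polynomial.nthRoots,
    hξ.nthRoots_eq hζ, Multiset.map_map, Finset.prod_eq_multiset_prod, Finset.range_val]
  refine congrArg Multiset.prod (Multiset.map_congr rfl fun i _ => ?_)
  have hcomm : (ξ ^ i) ^ p = (ξ ^ p) ^ i := by
    rw [← zpow_natCast, ← zpow_natCast, zpow_comm]
  rw [Function.comp_apply, mul_zpow, hcomm, mul_left_comm]
end

section
/- Let c₁, c₂ ∈ ℂ, let h ≥ 1 and d₁ ≥ 1 be integers, and let p ∈ ℤ. Set ε₂ = exp(−2π√−1·c₂) and ε₁ = exp(2π√−1·c₁). Let S be the ε₂-twisted cyclic shift matrix of size h over ℂ, let K = ε₁·S^p (defined since ε₂ ≠ 0 makes S invertible), and let L = L(K, d₁) be the block companion matrix of K of block size d₁. Then the characteristic polynomial of the (h·d₁)×(h·d₁) matrix L equals ∏_{k=0}^{h−1} ( X^{d₁} − exp(2π√−1·c₁)·exp(2π√−1·p·(k − c₂)/h) ). -/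
/-- The `ε`-twisted cyclic shift matrix of size `h`: entry `(i,j)` is `1` if `i = j + 1`,
`ε` if `i = 0` and `j = h - 1`, and `0` otherwise. -/
def twistedShift (R : Type*) [CommRing R] (h : ℕ) (ε : R) : Matrix (Fin h) (Fin h) R :=
  Matrix.of fun i j =>
    if (i : ℕ) = (j : ℕ) + 1 then 1
    else if (i : ℕ) = 0 ∧ (j : ℕ) = h - 1 then ε
    else 0

open Polynomial Matrix in
theorem Matrix.charpoly_eq_of_semiconjBy {n R : Type*} [Fintype n] [DecidableEq n] [CommRing R]
    {V A B : Matrix n n R} (hV : IsUnit V) (h : SemiconjBy V A B) : A.charpoly = B.charpoly := by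
  obtain ⟨V, rfl⟩ := hV
  rw [← charpoly_units_conj V A, h.eq, mul_assoc, ← coe_units_inv, Units.mul_inv, mul_one]

open Polynomial Matrix in
theorem Matrix.charpoly_blockDiagonal {m o R : Type*} [Fintype m] [DecidableEq m] [Fintype o]
    [DecidableEq o] [CommRing R] (M : o → Matrix m m R) :
    (blockDiagonal M).charpoly = ∏ k, (M k).charpoly := by
  have h : (blockDiagonal M).charmatrix = blockDiagonal fun k => (M k).charmatrix := by
    ext ⟨i, k⟩ ⟨j, l⟩
    by_cases hkl : k = l <;>
      simp [charmatrix_apply, blockDiagonal_apply, diagonal_apply, hkl]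
  simp only [Matrix.charpoly, h, det_blockDiagonal]

/-- The rows of a Vandermonde matrix on `h`-th roots of `ε` are left eigenvectors of the
`ε`-twisted cyclic shift. -/
theorem semiconjBy_vandermonde_twistedShift {R : Type*} [CommRing R] {h : ℕ} {ε : R}
    (μ : Fin h → R) (hμ : ∀ k, μ k ^ h = ε) :
    SemiconjBy (Matrix.vandermonde μ) (twistedShift R h ε) (Matrix.diagonal μ) := by
  ext k j
  have hj := j.isLt
  rw [Matrix.diagonal_mul, Matrix.mul_apply, Matrix.vandermonde_apply]
  by_cases hlast : (j : ℕ) + 1 < h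
  · rw [Finset.sum_eq_single ⟨(j : ℕ) + 1, hlast⟩]
    · simp [twistedShift, Matrix.vandermonde_apply, pow_succ']
    · intro i _ hi
      have h₁ : (i : ℕ) ≠ (j : ℕ) + 1 := fun h => hi (Fin.ext h)
      have h₂ : (j : ℕ) ≠ h - 1 := by omega
      simp [twistedShift, h₁, h₂]
    · simp
  · rw [Finset.sum_eq_single ⟨0, by omega⟩]
    · have h₂ : (j : ℕ) = h - 1 := by omega
      have h₃ : (j : ℕ) + 1 = h := by omega
      rw [← pow_succ', h₃, hμ k]
      simp [twistedShift, Matrix.vandermonde_apply, h₂]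
    · intro i _ hi
      have h₁ : (i : ℕ) ≠ (j : ℕ) + 1 := by omega
      have h₂ : (i : ℕ) ≠ 0 := fun h => hi (Fin.ext h)
      simp [twistedShift, h₁, h₂]
    · simp

theorem isUnit_vandermonde_primitiveRoot {K : Type*} [Field K] {h : ℕ} {ζ α : K}
    (hζ : IsPrimitiveRoot ζ h) (hα : α ≠ 0) :
    IsUnit (Matrix.vandermonde fun k : Fin h => ζ ^ (k : ℕ) * α) := by
  rw [Matrix.isUnit_iff_isUnit_det, isUnit_iff_ne_zero, Matrix.det_vandermonde_ne_zero_iff]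
  intro i j hij
  exact Fin.ext (hζ.pow_inj i.isLt j.isLt (mul_right_cancel₀ hα hij))

theorem IsPrimitiveRoot.pow_mul_pow {M : Type*} [CommMonoid M] {h : ℕ} {ζ : M}
    (hζ : IsPrimitiveRoot ζ h) (α : M) (k : ℕ) : (ζ ^ k * α) ^ h = α ^ h := by
  rw [mul_pow, ← pow_mul, mul_comm k, pow_mul, hζ.pow_eq_one, one_pow, one_mul]

open Polynomial in
theorem charpoly_twistedShift {d : ℕ} (hd : 1 ≤ d) {a : ℂ} (ha : a ≠ 0) :
    (twistedShift ℂ d a).charpoly = X ^ d - C a := by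
  obtain ⟨α, rfl⟩ := IsAlgClosed.exists_pow_nat_eq a hd
  have hα : α ≠ 0 := by
    rintro rfl
    exact ha (zero_pow (by omega))
  have hζ := Complex.isPrimitiveRoot_exp d (by omega)
  rw [Matrix.charpoly_eq_of_semiconjBy (isUnit_vandermonde_primitiveRoot hζ hα)
      (semiconjBy_vandermonde_twistedShift _ fun k => hζ.pow_mul_pow α k),
    Matrix.charpoly_diagonal, X_pow_sub_C_eq_prod hζ hd rfl, Finset.prod_range]

open scoped Kronecker in
theorem blockCompanion_eq_kronecker {R : Type*} [CommRing R] (h d : ℕ)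
    (A : Matrix (Fin h) (Fin h) R) :
    blockCompanion R h d A = twistedShift R d 0 ⊗ₖ 1 +
      (twistedShift R d 1 - twistedShift R d 0) ⊗ₖ A := by
  ext ⟨i, k⟩ ⟨j, l⟩
  simp only [blockCompanion, twistedShift, Matrix.add_apply, Matrix.sub_apply,
    Matrix.kronecker_apply, Matrix.of_apply, Matrix.one_apply]
  split_ifs <;> simp

theorem blockCompanion_diagonal {R : Type*} [CommRing R] (h d : ℕ) (v : Fin h → R) :
    blockCompanion R h d (Matrix.diagonal v) =
      Matrix.blockDiagonal fun k => twistedShift R d (v k) := by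
  ext ⟨i, k⟩ ⟨j, l⟩
  simp only [blockCompanion, twistedShift, Matrix.blockDiagonal_apply, Matrix.of_apply,
    Matrix.diagonal_apply]
  split_ifs <;> rfl

open scoped Kronecker in
theorem SemiconjBy.kronecker_blockCompanion {R : Type*} [CommRing R] {h : ℕ} (d : ℕ)
    {V A B : Matrix (Fin h) (Fin h) R} (hV : SemiconjBy V A B) :
    SemiconjBy ((1 : Matrix (Fin d) (Fin d) R) ⊗ₖ V) (blockCompanion R h d A)
      (blockCompanion R h d B) := by
  simp only [SemiconjBy, blockCompanion_eq_kronecker, mul_add, add_mul,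
    ← Matrix.mul_kronecker_mul, one_mul, mul_one, hV.eq]

open Polynomial in
theorem charpoly_blockCompanion_of_semiconjBy_diagonal {h d : ℕ} (hd : 1 ≤ d)
    {V A : Matrix (Fin h) (Fin h) ℂ} {v : Fin h → ℂ} (hV : IsUnit V)
    (hA : SemiconjBy V A (Matrix.diagonal v)) (hv : ∀ k, v k ≠ 0) :
    (blockCompanion ℂ h d A).charpoly = ∏ k, (X ^ d - C (v k)) := by
  rw [Matrix.charpoly_eq_of_semiconjBy _ (hA.kronecker_blockCompanion d), blockCompanion_diagonal,
    Matrix.charpoly_blockDiagonal]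
  · exact Finset.prod_congr rfl fun k _ => charpoly_twistedShift hd (hv k)
  · rw [Matrix.isUnit_iff_isUnit_det] at hV ⊢
    rw [Matrix.det_kronecker, Matrix.det_one, one_pow, one_mul]
    exact hV.pow _

theorem Matrix.diagonal_zpow_of_ne_zero {n K : Type*} [Fintype n] [DecidableEq n] [Field K]
    {v : n → K} (hv : ∀ k, v k ≠ 0) (p : ℤ) :
    Matrix.diagonal v ^ p = Matrix.diagonal fun k => v k ^ p := by
  cases p with
  | ofNat m => simp [Matrix.diagonal_pow, Pi.pow_def]
  | negSucc m =>
    rw [_root_.zpow_negSucc, Matrix.diagonal_pow]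
    refine Matrix.inv_eq_left_inv ?_
    rw [Matrix.diagonal_mul_diagonal, ← Matrix.diagonal_one]
    congr 1
    ext k
    simp [zpow_negSucc, hv k]


/-- with `ε₂ = exp(-2π√-1 c₂)`, `ε₁ = exp(2π√-1 c₁)`, `S` the `ε₂`-twisted
cyclic shift matrix of size `h`, `K = ε₁ • S^p` and `L = L(K, d₁)`, the characteristic
polynomial of `L` equals
`∏_{k=0}^{h-1} (X^{d₁} - exp(2π√-1 c₁) exp(2π√-1 p (k - c₂)/h))`. -/
theorem stmt_7 (c₁ c₂ : ℂ) (h d₁ : ℕ) (hh : 1 ≤ h) (hd : 1 ≤ d₁) (p : ℤ) :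
    (blockCompanion ℂ h d₁
        (Complex.exp (2 * (Real.pi : ℂ) * Complex.I * c₁) •
          (twistedShift ℂ h (Complex.exp (-(2 * (Real.pi : ℂ) * Complex.I * c₂))) ^ p))).charpoly
      = ∏ k : Fin h, (Polynomial.X ^ d₁ -
          Polynomial.C (Complex.exp (2 * (Real.pi : ℂ) * Complex.I * c₁) *
            Complex.exp (2 * (Real.pi : ℂ) * Complex.I * (p : ℂ) *
              (((k : ℕ) : ℂ) - c₂) / (h : ℂ)))) := by
  have hh' : (h : ℂ) ≠ 0 := by exact_mod_cast (by omega : h ≠ 0)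
  have hζ := Complex.isPrimitiveRoot_exp h (by omega)
  set α : ℂ := Complex.exp (-(2 * (Real.pi : ℂ) * Complex.I * c₂) / h) with hα
  have hα₀ : α ≠ 0 := Complex.exp_ne_zero _
  have hαh : α ^ h = Complex.exp (-(2 * (Real.pi : ℂ) * Complex.I * c₂)) := by
    rw [hα, ← Complex.exp_nat_mul, mul_div_cancel₀ _ hh']
  rw [← hαh]
  set μ : Fin h → ℂ :=
    fun k => Complex.exp (2 * (Real.pi : ℂ) * Complex.I / h) ^ (k : ℕ) * α with hμ
  have hμ₀ : ∀ k, μ k ≠ 0 := fun k => mul_ne_zero (pow_ne_zero _ (Complex.exp_ne_zero _)) hα₀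
  have hV : IsUnit (Matrix.vandermonde μ) := isUnit_vandermonde_primitiveRoot hζ hα₀
  have hS := semiconjBy_vandermonde_twistedShift μ fun k => hζ.pow_mul_pow α k
  have hD : IsUnit (Matrix.diagonal μ).det := by
    rw [Matrix.det_diagonal, isUnit_iff_ne_zero]
    exact Finset.prod_ne_zero_iff.2 fun k _ => hμ₀ k
  have hSu : IsUnit (twistedShift ℂ h (α ^ h)).det := by
    have hdet := congrArg Matrix.det hS.eq
    rw [Matrix.det_mul, Matrix.det_mul] at hdet
    have hVD := hD.mul ((Matrix.isUnit_iff_isUnit_det _).1 hV)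
    rw [← hdet] at hVD
    exact isUnit_of_mul_isUnit_right hVD
  have hSp := Matrix.SemiconjBy.zpow_right hSu hD hS p
  rw [Matrix.diagonal_zpow_of_ne_zero hμ₀] at hSp
  have hK : SemiconjBy (Matrix.vandermonde μ)
      (Complex.exp (2 * (Real.pi : ℂ) * Complex.I * c₁) • twistedShift ℂ h (α ^ h) ^ p)
      (Matrix.diagonal fun k => Complex.exp (2 * (Real.pi : ℂ) * Complex.I * c₁) * μ k ^ p) := by
    have hdiag : (Matrix.diagonal fun k => Complex.exp (2 * (Real.pi : ℂ) * Complex.I * c₁) *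
        μ k ^ p) = Complex.exp (2 * (Real.pi : ℂ) * Complex.I * c₁) •
          Matrix.diagonal fun k => μ k ^ p := by
      rw [← Matrix.diagonal_smul]
      rfl
    rw [hdiag, SemiconjBy, mul_smul_comm, smul_mul_assoc, hSp.eq]
  rw [charpoly_blockCompanion_of_semiconjBy_diagonal hd hV hK
    fun k => mul_ne_zero (Complex.exp_ne_zero _) (zpow_ne_zero _ (hμ₀ k))]
  refine Finset.prod_congr rfl fun k _ => ?_
  congr 3
  rw [hμ, hα]
  dsimp only
  rw [← Complex.exp_nat_mul, ← Complex.exp_add, ← Complex.exp_int_mul]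
  congr 1
  ring
end

section
/- Let n ≥ 1, let Δ ⊂ ℝⁿ be a compact convex set with 0 ∈ Δ, and let u₁, …, u_r ∈ ℝⁿ and c₁, …, c_r > 0 be such that ⟨u_i, x⟩ ≤ c_i for all x ∈ Δ and all i, and such that the affine hyperplanes H_i = { x ∈ ℝⁿ : ⟨u_i, x⟩ = c_i } are pairwise distinct as subsets of ℝⁿ. Set Δ_i = Δ ∩ H_i. Then Σ_{i=1}^{r} vol( conv( {0} ∪ Δ_i ) ) ≤ vol( Δ ), where vol denotes Lebesgue measure on ℝⁿ and conv the convex hull. -/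
open MeasureTheory in
/-- The pyramids with apex `0` over the faces of a convex set `s` cut out by distinct supporting
hyperplanes `f i = 1` have pairwise null intersections, so their volumes add up to at most that of
`s`. -/
theorem sum_measure_convexHull_zero_union_face_le {E ι : Type*} [NormedAddCommGroup E]
    [NormedSpace ℝ E] [FiniteDimensional ℝ E] [MeasurableSpace E] [BorelSpace E]
    (μ : Measure E) [μ.IsAddHaarMeasure] [Fintype ι] {s : Set E} (hs : Convex ℝ s)
    (h0 : (0 : E) ∈ s) (f : ι → E →ₗ[ℝ] ℝ) (hf : Function.Injective f)
    (hle : ∀ i, ∀ x ∈ s, f i x ≤ 1) :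
    ∑ i, μ (convexHull ℝ ({0} ∪ (s ∩ {x | f i x = 1}))) ≤ μ s := by
  have hmax (i k : ι) :
      convexHull ℝ ({0} ∪ (s ∩ {x | f i x = 1})) ⊆ {x | (f k - f i) x ≤ 0} := by
    refine convexHull_min ?_ (convex_halfSpace_le (f k - f i).isLinear 0)
    rintro x (rfl | ⟨hx, hxi⟩)
    · simp
    · have := hle k x hx
      simp_all
  have hdisj : Pairwise (Function.onFun (AEDisjoint μ)
      fun i ↦ convexHull ℝ ({0} ∪ (s ∩ {x | f i x = 1}))) := by
    intro i k hik
    refine measure_mono_null (t := (LinearMap.ker (f k - f i) : Set E)) ?_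
      (Measure.addHaar_submodule μ _ ?_)
    · rintro x ⟨hi, hk⟩
      have h₁ := hmax i k hi
      have h₂ := hmax k i hk
      simp only [Set.mem_ofPred_eq, LinearMap.sub_apply, SetLike.mem_coe, LinearMap.mem_ker]
        at h₁ h₂ ⊢
      linarith
    · rw [Ne, LinearMap.ker_eq_top, sub_eq_zero]
      exact fun h ↦ hik (hf h.symm)
  rw [← tsum_fintype (L := .unconditional ι),
    ← measure_iUnion₀ hdisj fun i ↦ (convex_convexHull ℝ _).nullMeasurableSet μ]
  refine measure_mono (Set.iUnion_subset fun i ↦ convexHull_min ?_ hs)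
  exact Set.union_subset (Set.singleton_subset_iff.2 h0) Set.inter_subset_left



/-- let `Δ ⊆ ℝⁿ` be compact convex with `0 ∈ Δ`, and let
`u₁, …, u_r ∈ ℝⁿ`, `c₁, …, c_r > 0` with `⟨u i, x⟩ ≤ c i` for all `x ∈ Δ`, the affine
hyperplanes `H_i = {x | ⟨u i, x⟩ = c i}` being pairwise distinct as subsets of `ℝⁿ`.
With `Δ_i = Δ ∩ H_i`, one has `∑ i, vol(conv({0} ∪ Δ_i)) ≤ vol(Δ)`. -/
theorem stmt_13 (n : ℕ) (hn : 1 ≤ n) (Δ : Set (Fin n → ℝ))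
    (hcpt : IsCompact Δ) (hconv : Convex ℝ Δ) (h0 : (0 : Fin n → ℝ) ∈ Δ)
    (r : ℕ) (u : Fin r → (Fin n → ℝ)) (c : Fin r → ℝ) (hc : ∀ i, 0 < c i)
    (hsupp : ∀ i, ∀ x ∈ Δ, ∑ j, u i j * x j ≤ c i)
    (hdist : ∀ i i' : Fin r, i ≠ i' →
      {x : Fin n → ℝ | ∑ j, u i j * x j = c i} ≠ {x : Fin n → ℝ | ∑ j, u i' j * x j = c i'}) :
    ∑ i : Fin r, MeasureTheory.volume
        (convexHull ℝ ({0} ∪ (Δ ∩ {x : Fin n → ℝ | ∑ j, u i j * x j = c i})))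
      ≤ MeasureTheory.volume Δ := by
  let f (i : Fin r) : (Fin n → ℝ) →ₗ[ℝ] ℝ := (c i)⁻¹ • ∑ j, u i j • LinearMap.proj j
  have hf_apply (i : Fin r) (x : Fin n → ℝ) : f i x = (∑ j, u i j * x j) / c i := by
    simp [f, div_eq_inv_mul]
  have hf_eq (i : Fin r) : {x | f i x = 1} = {x | ∑ j, u i j * x j = c i} := by
    ext x
    simp [hf_apply, div_eq_one_iff_eq (hc i).ne']
  have hf : Function.Injective f := by
    intro i k hik
    by_contra hne
    exact hdist i k hne (by rw [← hf_eq, ← hf_eq, hik])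
  have hle (i : Fin r) (x : Fin n → ℝ) (hx : x ∈ Δ) : f i x ≤ 1 := by
    rw [hf_apply, div_le_one (hc i)]
    exact hsupp i x hx
  simpa only [hf_eq] using
    sum_measure_convexHull_zero_union_face_le MeasureTheory.volume hconv h0 f hf hle
end
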